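/- Let (𝒜, 𝒜', 𝒜'') be the triple with respect to the last hyperplane H_n: 𝒜' = 𝒜 ∖ {H_n} with the induced linear order, and 𝒜'' = {H ∩ H_n : H ∈ 𝒜', H ∩ H_n ≠ ∅}, an arrangement in H_n, ordered by H'' < K'' iff ν(H'') < ν(K''), where ν(H'') denotes the smallest hyperplane of 𝒜 containing H''. If H_n is a separator, i.e. the rank of 𝒜' is less than r, then βnbc(𝒜) = ∅. Otherwise βnbc(𝒜) = βnbc(𝒜') ∪ { (ν(H''_{i_1}), …, ν(H''_{i_{r-1}}), H_n) : (H''_{i_1}, …, H''_{i_{r-1}}) ∈ βnbc(𝒜'') }, where ν is applied componentwise. -/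

import Mathlib

open Module

noncomputable section

/-- An arrangement of `n` (affine) hyperplanes inside the ambient affine subspace `amb`
of the complex vector space `W`.  The linear order on the hyperplanes is the order of the
indices in `Fin n`; an arbitrary linear order is encoded by a permutation `σ` of `Fin n`,
with `i ≺ j ↔ σ i < σ j`. -/
structure HArr (W : Type) [AddCommGroup W] [Module ℂ W] (n : ℕ) where
  amb : AffineSubspace ℂ W
  amb_ne : (amb : Set W).Nonempty
  H : Fin n → AffineSubspace ℂ W
  inj : Function.Injective H
  le_amb : ∀ i, H i ≤ amb
  nonemptyH : ∀ i, ((H i : Set W)).Nonempty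
  hyp : ∀ i, finrank ℂ (H i).direction + 1 = finrank ℂ amb.direction

namespace HArr

variable {W : Type} [AddCommGroup W] [Module ℂ W] {n : ℕ}

/-- The intersection `⋂ S` of a subset of the arrangement (the ambient space for `S = ∅`). -/
def inter (A : HArr W n) (S : Finset (Fin n)) : AffineSubspace ℂ W :=
  A.amb ⊓ S.inf A.H

/-- Codimension (inside the ambient space) of an affine subspace. -/
def cd (A : HArr W n) (X : AffineSubspace ℂ W) : ℕ :=
  finrank ℂ A.amb.direction - finrank ℂ X.direction

/-- A dependent subset of the arrangement. -/
def dep (A : HArr W n) (S : Finset (Fin n)) : Prop :=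
  A.inter S ≠ ⊥ ∧ A.cd (A.inter S) < S.card

/-- An independent subset of the arrangement. -/
def indep (A : HArr W n) (S : Finset (Fin n)) : Prop :=
  A.inter S ≠ ⊥ ∧ A.cd (A.inter S) = S.card

/-- A base: a maximal independent subset. -/
def isBase (A : HArr W n) (S : Finset (Fin n)) : Prop :=
  A.indep S ∧ ∀ T, A.indep T → S ⊆ T → S = T

open scoped Classical in
/-- The rank of a subarrangement `{H i : i ∈ C}`. -/
def rankOn (A : HArr W n) (C : Finset (Fin n)) : ℕ :=
  C.powerset.sup fun S => if A.indep S then S.card else 0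

/-- The rank `r` of the arrangement. -/
def rank (A : HArr W n) : ℕ := A.rankOn Finset.univ

/-- A circuit: an inclusion-minimal dependent set. -/
def circuit (A : HArr W n) (S : Finset (Fin n)) : Prop :=
  A.dep S ∧ ∀ T ⊂ S, ¬ A.dep T

/-- A broken circuit w.r.t. the linear order given by `σ`. -/
def brokenCircuit (A : HArr W n) (σ : Equiv.Perm (Fin n)) (S : Finset (Fin n)) : Prop :=
  ∃ i ∉ S, (∀ j ∈ S, σ i < σ j) ∧ A.circuit (insert i S)

/-- An nbc set: nonempty intersection and containing no broken circuit. -/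
def nbcSet (A : HArr W n) (σ : Equiv.Perm (Fin n)) (S : Finset (Fin n)) : Prop :=
  A.inter S ≠ ⊥ ∧ ∀ T ⊆ S, ¬ A.brokenCircuit σ T

/-- An nbc-base. -/
def nbcBase (A : HArr W n) (σ : Equiv.Perm (Fin n)) (S : Finset (Fin n)) : Prop :=
  A.nbcSet σ S ∧ A.isBase S

/-- A βnbc-base. -/
def betaNbcBase (A : HArr W n) (σ : Equiv.Perm (Fin n)) (S : Finset (Fin n)) : Prop :=
  A.nbcBase σ S ∧ ∀ i ∈ S, ∃ j, σ j < σ i ∧ A.isBase (insert j (S.erase i))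

/-- Membership in the intersection poset `L(𝒜)`. -/
def memL (A : HArr W n) (X : AffineSubspace ℂ W) : Prop :=
  X ≠ ⊥ ∧ ∃ S : Finset (Fin n), A.inter S = X

/-- A maximal element of `L(𝒜)` (in the reverse-inclusion order). -/
def maximalL (A : HArr W n) (X : AffineSubspace ℂ W) : Prop :=
  A.memL X ∧ ∀ Y, A.memL Y → Y ≤ X → Y = X

open scoped Classical in
/-- The set of indices of hyperplanes containing `X`, i.e. `𝒜_X`. -/
def sub (A : HArr W n) (X : AffineSubspace ℂ W) : Finset (Fin n) :=
  Finset.univ.filter fun i => X ≤ A.H i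

/-- `X` is dense: `𝒜_X` admits no decomposition into two nonempty parts. -/
def denseL (A : HArr W n) (X : AffineSubspace ℂ W) : Prop :=
  ¬ ∃ S T : Finset (Fin n), Disjoint S T ∧ S.Nonempty ∧ T.Nonempty ∧
      S ∪ T = A.sub X ∧ A.cd (A.inter S) + A.cd (A.inter T) = A.cd X

/-- `i` is the minimum of `S` w.r.t. the linear order given by `σ`. -/
def isMin (σ : Equiv.Perm (Fin n)) (i : Fin n) (S : Finset (Fin n)) : Prop :=
  i ∈ S ∧ ∀ j ∈ S, σ i ≤ σ j

/-- The standard ordered tuple of a finite set, w.r.t. the linear order given by `σ`: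
`tup σ S p` is the element of `S` with `(p+1)`-st smallest `σ`-value. -/
def tup (σ : Equiv.Perm (Fin n)) (S : Finset (Fin n)) (p : Fin S.card) : Fin n :=
  σ.symm (((S.image ⇑σ).orderIsoOfFin (Finset.card_image_of_injective S σ.injective) p).1)

/-- The flag `ξ(B) = (X_1 > ⋯ > X_r)` of a standard ordered base:
`flag σ S p = X_{p+1} = ⋂_{k ≥ p} H_{i_k}`. -/
def flag (A : HArr W n) (σ : Equiv.Perm (Fin n)) (S : Finset (Fin n)) (p : Fin S.card) :
    AffineSubspace ℂ W :=
  A.inter (S.filter fun i => σ (tup σ S p) ≤ σ i)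

/-- Lexicographic order on standard ordered tuples (for the canonical order). -/
def lexLt (S T : Finset (Fin n)) : Prop :=
  List.Lex (· < ·) (S.sort (· ≤ ·)) (T.sort (· ≤ ·))

/-- `λ(X) = Σ_{H_i ∈ 𝒜_X} λ_i`. -/
def lamX (A : HArr W n) (lam : Fin n → ℂ) (X : AffineSubspace ℂ W) : ℂ :=
  ∑ i ∈ A.sub X, lam i

/-- `X` is unmixed (w.r.t. the order `σ`). -/
def unmixedX (A : HArr W n) (σ : Equiv.Perm (Fin n)) (X : AffineSubspace ℂ W) : Prop :=
  (∀ S, A.nbcBase σ S → A.inter S = X → A.betaNbcBase σ S) ∨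
  (∀ S, A.nbcBase σ S → A.inter S = X → ¬ A.betaNbcBase σ S)

/-- The linear order given by `σ` is unmixed. -/
def unmixedOrd (A : HArr W n) (σ : Equiv.Perm (Fin n)) : Prop :=
  ∀ X, A.maximalL X → A.unmixedX σ X

/-- Membership in the intersection poset of the deleted arrangement `𝒜 ∖ {H_{i₀}}`. -/
def memLdel (A : HArr W n) (i₀ : Fin n) (X : AffineSubspace ℂ W) : Prop :=
  X ≠ ⊥ ∧ ∃ S : Finset (Fin n), i₀ ∉ S ∧ A.inter S = X

/-- A maximal element of the intersection poset of the deleted arrangement. -/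
def maximalLdel (A : HArr W n) (i₀ : Fin n) (X : AffineSubspace ℂ W) : Prop :=
  A.memLdel i₀ X ∧ ∀ Y, A.memLdel i₀ Y → Y ≤ X → Y = X

/-- The generator `e_i` of the exterior algebra `E`. -/
def gen (i : Fin n) : ExteriorAlgebra ℂ (Fin n → ℂ) :=
  ExteriorAlgebra.ι ℂ (Pi.single i 1)

/-- `e_S = e_{i_1} ∧ ⋯ ∧ e_{i_p}` for `S = {i_1 < ⋯ < i_p}`. -/
def eS (S : Finset (Fin n)) : ExteriorAlgebra ℂ (Fin n → ℂ) :=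
  ((S.sort (· ≤ ·)).map gen).prod

/-- `∂e_S = Σ_k (−1)^{k−1} e_{S ∖ {i_k}}`. -/
def bdry (S : Finset (Fin n)) : ExteriorAlgebra ℂ (Fin n → ℂ) :=
  ∑ i ∈ S, ((-1 : ℂ) ^ (S.filter fun j => j < i).card) • eS (S.erase i)

/-- The defining relations of the Orlik–Solomon algebra. -/
inductive OSRel (A : HArr W n) :
    ExteriorAlgebra ℂ (Fin n → ℂ) → ExteriorAlgebra ℂ (Fin n → ℂ) → Prop
  | isBot : ∀ S : Finset (Fin n), A.inter S = ⊥ → OSRel A (eS S) 0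
  | isDep : ∀ S : Finset (Fin n), A.dep S → OSRel A (bdry S) 0

/-- The Orlik–Solomon algebra `A(𝒜)`: the exterior algebra modulo the ideal generated by
the `e_S` with empty intersection and the `∂e_S` with `S` dependent. -/
abbrev OS (A : HArr W n) := RingQuot (OSRel A)

/-- The quotient map `E → A(𝒜)`. -/
def osMk (A : HArr W n) : ExteriorAlgebra ℂ (Fin n → ℂ) →ₐ[ℂ] OS A :=
  RingQuot.mkAlgHom ℂ (OSRel A)

/-- `ω_i`, the image of `e_i` in the Orlik–Solomon algebra. -/
def om (A : HArr W n) (i : Fin n) : OS A := osMk A (gen i)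

/-- `ω_B`, the image of `e_B` in the Orlik–Solomon algebra. -/
def omB (A : HArr W n) (S : Finset (Fin n)) : OS A := osMk A (eS S)

/-- The degree `p` part `A^p` of the Orlik–Solomon algebra. -/
def deg (A : HArr W n) (p : ℕ) : Submodule ℂ (OS A) :=
  Submodule.span ℂ {x | ∃ S : Finset (Fin n), S.card = p ∧ x = omB A S}

/-- `ω_λ = Σ_i λ_i ω_i`. -/
def omLam (A : HArr W n) (lam : Fin n → ℂ) : OS A := ∑ i, lam i • om A i

/-- `ω_λ(X) = Σ_{H_i ∈ 𝒜_X} λ_i ω_i`. -/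
def omLamX (A : HArr W n) (lam : Fin n → ℂ) (X : AffineSubspace ℂ W) : OS A :=
  ∑ i ∈ A.sub X, lam i • om A i

/-- The form `Ξ(B) = ω_λ(X_1) ⋯ ω_λ(X_r)` attached to a standard ordered base. -/
def Xi (A : HArr W n) (σ : Equiv.Perm (Fin n)) (lam : Fin n → ℂ) (S : Finset (Fin n)) :
    OS A :=
  ((List.finRange S.card).map fun p => A.omLamX lam (A.flag σ S p)).prod

/-- The submodule `ω_λ ∧ A^p` of the Orlik-Solomon algebra. -/
def Ideg (A : HArr W n) (lam : Fin n → ℂ) (p : ℕ) : Submodule ℂ (OS A) :=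
  (A.deg p).map (LinearMap.mulLeft ℂ (A.omLam lam))

end HArr

namespace HArr

variable {W : Type} [AddCommGroup W] [Module ℂ W] {n : ℕ}

lemma mem_inter (A : HArr W n) {S : Finset (Fin n)} {p : W} :
    p ∈ A.inter S ↔ p ∈ A.amb ∧ ∀ i ∈ S, p ∈ A.H i := by
  have h : p ∈ S.inf A.H ↔ ∀ i ∈ S, p ∈ A.H i := by
    induction S using Finset.induction_on with
    | empty => simp
    | insert i S _ ih => simp [AffineSubspace.mem_inf_iff, ih]
  rw [inter, AffineSubspace.mem_inf_iff, h]

lemma inter_le_amb (A : HArr W n) (S : Finset (Fin n)) : A.inter S ≤ A.amb := inf_le_left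

lemma inter_le (A : HArr W n) {S : Finset (Fin n)} {i : Fin n} (hi : i ∈ S) :
    A.inter S ≤ A.H i :=
  inf_le_right.trans (Finset.inf_le hi)

lemma inter_anti (A : HArr W n) {S T : Finset (Fin n)} (h : S ⊆ T) : A.inter T ≤ A.inter S :=
  inf_le_inf_left _ (Finset.inf_mono h)

lemma inter_insert (A : HArr W n) (S : Finset (Fin n)) (i : Fin n) :
    A.inter (insert i S) = A.inter S ⊓ A.H i := by
  simp only [inter, Finset.inf_insert]
  ac_rfl

lemma inter_empty (A : HArr W n) : A.inter ∅ = A.amb := by simp [inter]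

lemma exists_mem_of_ne_bot {X : AffineSubspace ℂ W} (h : X ≠ ⊥) : ∃ p, p ∈ X :=
  (AffineSubspace.nonempty_iff_ne_bot _).2 h

lemma ne_bot_of_mem {X : AffineSubspace ℂ W} {p : W} (h : p ∈ X) : X ≠ ⊥ :=
  (AffineSubspace.nonempty_iff_ne_bot _).1 ⟨p, h⟩

lemma ne_bot_mono {X Y : AffineSubspace ℂ W} (h : X ≤ Y) (hX : X ≠ ⊥) : Y ≠ ⊥ :=
  fun hY => hX (le_bot_iff.1 (hY ▸ h))

lemma le_of_direction_le {X Y : AffineSubspace ℂ W} (hXY : X ⊓ Y ≠ ⊥)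
    (h : X.direction ≤ Y.direction) : X ≤ Y := by
  obtain ⟨p, hp⟩ := exists_mem_of_ne_bot hXY
  rw [AffineSubspace.mem_inf_iff] at hp
  intro q hq
  have := AffineSubspace.vadd_mem_of_mem_direction
    (h (AffineSubspace.vsub_mem_direction hq hp.1)) hp.2
  simpa using this

lemma direction_inter_le (A : HArr W n) {S T : Finset (Fin n)} (hT : A.inter T ≠ ⊥)
    (h : ∀ i ∈ T, (A.inter S).direction ≤ (A.H i).direction) :
    (A.inter S).direction ≤ (A.inter T).direction := by
  obtain ⟨p, hp⟩ := exists_mem_of_ne_bot hT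
  intro v hv
  have hp' := A.mem_inter.1 hp
  have : v +ᵥ p ∈ A.inter T := A.mem_inter.2
    ⟨AffineSubspace.vadd_mem_of_mem_direction
      (AffineSubspace.direction_le (A.inter_le_amb S) hv) hp'.1,
     fun i hi => AffineSubspace.vadd_mem_of_mem_direction (h i hi hv) (hp'.2 i hi)⟩
  simpa using AffineSubspace.vsub_mem_direction this hp

lemma notMem_of_not_direction_le (A : HArr W n) {S : Finset (Fin n)} {i : Fin n}
    (h : ¬ (A.inter S).direction ≤ (A.H i).direction) : i ∉ S :=
  fun hi => h (AffineSubspace.direction_le (A.inter_le hi))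

lemma indep.card_le_rank {A : HArr W n} {S : Finset (Fin n)} (hS : A.indep S) :
    S.card ≤ A.rank := by
  classical
  have := Finset.le_sup (f := fun S => if A.indep S then S.card else 0)
    (Finset.mem_powerset.2 (Finset.subset_univ S))
  simp only [if_pos hS] at this
  unfold rank rankOn
  convert this

lemma not_amb_le (A : HArr W n) (i : Fin n) : ¬ A.amb ≤ A.H i := by
  intro h
  have := A.hyp i
  rw [le_antisymm h (A.le_amb i)] at this
  omega

section FiniteDimensional

variable [FiniteDimensional ℂ W]

lemma direction_sup_eq (A : HArr W n) {X : AffineSubspace ℂ W} (hX : X ≤ A.amb) {i : Fin n}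
    (h : ¬ X.direction ≤ (A.H i).direction) :
    X.direction ⊔ (A.H i).direction = A.amb.direction := by
  have hle : X.direction ⊔ (A.H i).direction ≤ A.amb.direction :=
    sup_le (AffineSubspace.direction_le hX) (AffineSubspace.direction_le (A.le_amb i))
  have hlt : (A.H i).direction < X.direction ⊔ (A.H i).direction :=
    lt_of_le_of_ne le_sup_right fun he => h (he ▸ le_sup_left)
  refine Submodule.eq_of_le_of_finrank_le hle ?_
  have := Submodule.finrank_lt_finrank_of_lt hlt
  have := A.hyp i
  omega

lemma inf_ne_bot (A : HArr W n) {X : AffineSubspace ℂ W} (hX : X ≤ A.amb) (hX' : X ≠ ⊥)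
    {i : Fin n} (h : ¬ X.direction ≤ (A.H i).direction) : X ⊓ A.H i ≠ ⊥ := by
  obtain ⟨x, hx⟩ := exists_mem_of_ne_bot hX'
  obtain ⟨y, hy⟩ := A.nonemptyH i
  have hxy := AffineSubspace.vsub_mem_direction (hX hx) (A.le_amb i hy)
  rw [← A.direction_sup_eq hX h, Submodule.mem_sup] at hxy
  obtain ⟨u, hu, v, hv, huv⟩ := hxy
  have h1 := AffineSubspace.vadd_mem_of_mem_direction (neg_mem hu) hx
  have h2 := AffineSubspace.vadd_mem_of_mem_direction hv hy
  have h3 : -u +ᵥ x = v +ᵥ y := by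
    simp only [vadd_eq_add, vsub_eq_sub] at huv ⊢
    rw [neg_add_eq_iff_eq_add, ← add_assoc, huv, sub_add_cancel]
  exact ne_bot_of_mem (p := v +ᵥ y) ((AffineSubspace.mem_inf_iff _ _ _).2 ⟨h3 ▸ h1, h2⟩)

lemma finrank_inf (A : HArr W n) {X : AffineSubspace ℂ W} (hX : X ≤ A.amb) (hX' : X ≠ ⊥)
    {i : Fin n} (h : ¬ X.direction ≤ (A.H i).direction) :
    finrank ℂ (X ⊓ A.H i).direction + 1 = finrank ℂ X.direction := by
  obtain ⟨p, hp⟩ := exists_mem_of_ne_bot (A.inf_ne_bot hX hX' h)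
  rw [AffineSubspace.mem_inf_iff] at hp
  rw [AffineSubspace.direction_inf_of_mem hp.1 hp.2]
  have h1 := Submodule.finrank_sup_add_finrank_inf_eq X.direction (A.H i).direction
  rw [A.direction_sup_eq hX h] at h1
  have := A.hyp i
  omega

lemma finrank_amb_le (A : HArr W n) {S : Finset (Fin n)} (hS : A.inter S ≠ ⊥) :
    finrank ℂ A.amb.direction ≤ finrank ℂ (A.inter S).direction + S.card := by
  induction S using Finset.induction_on with
  | empty => rw [inter_empty]; exact Nat.le_add_right _ _
  | insert i S hi ih =>
    have hS' := ne_bot_mono (A.inter_anti (Finset.subset_insert i S)) hS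
    have := ih hS'
    rw [Finset.card_insert_of_notMem hi]
    rw [inter_insert] at hS ⊢
    by_cases h : (A.inter S).direction ≤ (A.H i).direction
    · rw [inf_eq_left.2 (le_of_direction_le hS h)]
      omega
    · have := A.finrank_inf (A.inter_le_amb S) hS' h
      omega

lemma indep_iff (A : HArr W n) {S : Finset (Fin n)} :
    A.indep S ↔ A.inter S ≠ ⊥ ∧
      finrank ℂ (A.inter S).direction + S.card = finrank ℂ A.amb.direction := by
  have := Submodule.finrank_mono (AffineSubspace.direction_le (A.inter_le_amb S))
  unfold indep cd
  refine and_congr_right fun _ => ?_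
  omega

lemma indep_insert (A : HArr W n) {S : Finset (Fin n)} {i : Fin n} (hi : i ∉ S) :
    A.indep (insert i S) ↔ A.indep S ∧ ¬ (A.inter S).direction ≤ (A.H i).direction := by
  rw [indep_iff, indep_iff, Finset.card_insert_of_notMem hi, inter_insert]
  constructor
  · rintro ⟨h1, h2⟩
    have hS : A.inter S ≠ ⊥ := ne_bot_mono inf_le_left h1
    have hle := A.finrank_amb_le hS
    by_cases h : (A.inter S).direction ≤ (A.H i).direction
    · rw [inf_eq_left.2 (le_of_direction_le h1 h)] at h2
      omega
    · have := A.finrank_inf (A.inter_le_amb S) hS h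
      exact ⟨⟨hS, by omega⟩, h⟩
  · rintro ⟨⟨h1, h2⟩, h⟩
    have := A.finrank_inf (A.inter_le_amb S) h1 h
    exact ⟨A.inf_ne_bot (A.inter_le_amb S) h1 h, by omega⟩

lemma indep.subset {A : HArr W n} {S T : Finset (Fin n)} (hT : A.indep T) (h : S ⊆ T) :
    A.indep S := by
  induction T using Finset.strongInduction with
  | H T ih =>
    rcases h.eq_or_ssubset with rfl | h'
    · exact hT
    · obtain ⟨i, hi, hS⟩ := Finset.exists_of_ssubset h'
      refine ih (T.erase i) (Finset.erase_ssubset hi) ?_ (Finset.subset_erase.2 ⟨h, hS⟩)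
      rw [← Finset.insert_erase hi] at hT
      exact ((A.indep_insert (Finset.notMem_erase i T)).1 hT).1

lemma isBase_iff (A : HArr W n) {S : Finset (Fin n)} :
    A.isBase S ↔ A.indep S ∧ ∀ i, (A.inter S).direction ≤ (A.H i).direction := by
  refine and_congr_right fun hS => ⟨fun h i => ?_, fun h T hT hST => ?_⟩
  · by_contra hi
    have hiS := A.notMem_of_not_direction_le hi
    exact hiS ((h _ ((A.indep_insert hiS).2 ⟨hS, hi⟩) (Finset.subset_insert i S)).symm ▸
      Finset.mem_insert_self i S)
  · by_contra hne
    obtain ⟨i, hi, hiS⟩ := Finset.exists_of_ssubset (hST.ssubset_of_ne hne)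
    exact ((A.indep_insert hiS).1 (hT.subset (Finset.insert_subset hi hST))).2 (h i)

lemma isBase.card_eq_rank {A : HArr W n} {S : Finset (Fin n)} (hS : A.isBase S) :
    S.card = A.rank := by
  refine le_antisymm hS.1.card_le_rank ?_
  unfold rank rankOn
  refine Finset.sup_le fun T _ => ?_
  split_ifs with hT
  · rw [isBase_iff] at hS
    have h1 := Submodule.finrank_mono (A.direction_inter_le hT.1 fun i _ => hS.2 i)
    have h2 := (A.indep_iff.1 hT).2
    have h3 := (A.indep_iff.1 hS.1).2
    omega
  · exact Nat.zero_le _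

lemma isBase_iff_card (A : HArr W n) {S : Finset (Fin n)} :
    A.isBase S ↔ A.indep S ∧ S.card = A.rank :=
  ⟨fun h => ⟨h.1, h.card_eq_rank⟩, fun h => ⟨h.1, fun _ hT hST =>
    Finset.eq_of_subset_of_card_le hST (h.2 ▸ hT.card_le_rank)⟩⟩

lemma isBase_insert_erase (A : HArr W n) {S : Finset (Fin n)} (hS : A.isBase S) {i j : Fin n}
    (hi : i ∈ S) : A.isBase (insert j (S.erase i)) ↔
      ¬ (A.inter (S.erase i)).direction ≤ (A.H j).direction := by
  have hind := hS.1.subset (Finset.erase_subset i S)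
  have hcard := Finset.card_erase_add_one hi
  constructor
  · intro h
    have hj : j ∉ S.erase i := by
      intro hj
      rw [Finset.insert_eq_of_mem hj] at h
      have := h.card_eq_rank
      have := hS.card_eq_rank
      omega
    exact ((A.indep_insert hj).1 h.1).2
  · intro h
    have hj := A.notMem_of_not_direction_le h
    refine A.isBase_iff_card.2 ⟨(A.indep_insert hj).2 ⟨hind, h⟩, ?_⟩
    rw [Finset.card_insert_of_notMem hj, hcard, hS.card_eq_rank]

lemma circuit_insert_of_minimal (A : HArr W n) {S : Finset (Fin n)} (hS : A.indep S) {i : Fin n}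
    (hi : i ∉ S) (h : A.inter S ≤ A.H i) (hmin : ∀ T ⊂ S, ¬ A.inter T ≤ A.H i) :
    A.circuit (insert i S) := by
  refine ⟨?_, fun U hU hdep => ?_⟩
  · rw [dep, inter_insert, inf_eq_left.2 h, Finset.card_insert_of_notMem hi]
    exact ⟨hS.1, by rw [hS.2]; exact Nat.lt_succ_self _⟩
  · suffices A.indep U from hdep.2.ne this.2
    by_cases hiU : i ∈ U
    · have hsub : U.erase i ⊂ S := ⟨Finset.subset_insert_iff.1 hU.subset, fun hSU =>
        hU.2 (Finset.insert_subset hiU (hSU.trans (Finset.erase_subset i U)))⟩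
      have hU' := hdep.1
      rw [← Finset.insert_erase hiU, inter_insert] at hU'
      rw [← Finset.insert_erase hiU, A.indep_insert (Finset.notMem_erase i U)]
      exact ⟨hS.subset hsub.subset, fun hd => hmin _ hsub (le_of_direction_le hU' hd)⟩
    · exact hS.subset ((Finset.subset_insert_iff_of_notMem hiU).1 hU.subset)

lemma nbcSet_iff (A : HArr W n) (σ : Equiv.Perm (Fin n)) {S : Finset (Fin n)} (hS : A.indep S) :
    A.nbcSet σ S ↔ ∀ i, ¬ A.inter (S.filter fun j => σ i < σ j) ≤ A.H i := by
  constructor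
  · rintro ⟨_, h⟩ i hi
    obtain ⟨T, hTF, hT⟩ := exists_minimal_le_of_wellFoundedLT
      (fun T : Finset (Fin n) => A.inter T ≤ A.H i) _ hi
    have hlt : ∀ j ∈ T, σ i < σ j := fun j hj => (Finset.mem_filter.1 (hTF hj)).2
    have hTS : T ⊆ S := fun j hj => (Finset.mem_filter.1 (hTF hj)).1
    have hiT : i ∉ T := fun hi' => lt_irrefl _ (hlt i hi')
    exact h T hTS ⟨i, hiT, hlt, A.circuit_insert_of_minimal (hS.subset hTS) hiT hT.prop
      fun U hU => hT.not_prop_of_lt hU⟩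
  · refine fun h => ⟨hS.1, fun T hTS ⟨i, hiT, hlt, hc⟩ => h i ?_⟩
    have hd : (A.inter T).direction ≤ (A.H i).direction := by
      by_contra hd
      exact hc.1.2.ne ((A.indep_insert hiT).2 ⟨hS.subset hTS, hd⟩).2
    have hne := hc.1.1
    rw [inter_insert] at hne
    exact (A.inter_anti fun j hj => Finset.mem_filter.2 ⟨hTS hj, hlt j hj⟩).trans
      (le_of_direction_le hne hd)

lemma betaNbcBase_iff (A : HArr W n) (σ : Equiv.Perm (Fin n)) {S : Finset (Fin n)} :
    A.betaNbcBase σ S ↔ A.isBase S ∧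
      (∀ i, ¬ A.inter (S.filter fun j => σ i < σ j) ≤ A.H i) ∧
      ∀ i ∈ S, ∃ j, σ j < σ i ∧ ¬ (A.inter (S.erase i)).direction ≤ (A.H j).direction := by
  constructor
  · rintro ⟨⟨h1, h2⟩, h3⟩
    refine ⟨h2, (A.nbcSet_iff σ h2.1).1 h1, fun i hi => ?_⟩
    obtain ⟨j, hj, hb⟩ := h3 i hi
    exact ⟨j, hj, (A.isBase_insert_erase h2 hi).1 hb⟩
  · rintro ⟨h2, h1, h3⟩
    refine ⟨⟨(A.nbcSet_iff σ h2.1).2 h1, h2⟩, fun i hi => ?_⟩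
    obtain ⟨j, hj, hb⟩ := h3 i hi
    exact ⟨j, hj, (A.isBase_insert_erase h2 hi).2 hb⟩

lemma betaNbcBase_one_iff (A : HArr W n) {S : Finset (Fin n)} :
    A.betaNbcBase 1 S ↔ A.isBase S ∧
      (∀ i, ¬ A.inter (S.filter fun j => i < j) ≤ A.H i) ∧
      ∀ i ∈ S, ∃ j, j < i ∧ ¬ (A.inter (S.erase i)).direction ≤ (A.H j).direction :=
  A.betaNbcBase_iff 1

lemma direction_eq_of_inf_eq_bot (A : HArr W n) {i j : Fin n} (h : A.H i ⊓ A.H j = ⊥) :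
    (A.H i).direction = (A.H j).direction := by
  refine Submodule.eq_of_le_of_finrank_eq ?_ (by have := A.hyp i; have := A.hyp j; omega)
  by_contra hd
  exact A.inf_ne_bot (A.le_amb i)
    ((AffineSubspace.nonempty_iff_ne_bot _).1 (A.nonemptyH i)) hd h

end FiniteDimensional

section Deletion

variable {A : HArr W (n + 1)} {A' : HArr W n}

lemma exists_eq_image_castSucc {S : Finset (Fin (n + 1))} (h : Fin.last n ∉ S) :
    ∃ T : Finset (Fin n), S = T.image Fin.castSucc := by
  refine ⟨Finset.univ.filter fun i => i.castSucc ∈ S, ?_⟩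
  ext i
  induction i using Fin.lastCases with
  | last => simpa [Fin.castSucc_ne_last] using h
  | cast i => simp

lemma inter_image_castSucc (hamb' : A'.amb = A.amb)
    (hH' : ∀ i : Fin n, A'.H i = A.H i.castSucc) (S : Finset (Fin n)) :
    A.inter (S.image Fin.castSucc) = A'.inter S := by
  ext p
  simp [mem_inter, hamb', hH']

lemma indep_image_castSucc (hamb' : A'.amb = A.amb)
    (hH' : ∀ i : Fin n, A'.H i = A.H i.castSucc) {S : Finset (Fin n)} :
    A.indep (S.image Fin.castSucc) ↔ A'.indep S := by
  unfold indep cd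
  rw [inter_image_castSucc hamb' hH', hamb',
    Finset.card_image_of_injective S (Fin.castSucc_injective n)]

variable [FiniteDimensional ℂ W]

lemma not_betaNbcBase_of_rank_lt (hamb' : A'.amb = A.amb)
    (hH' : ∀ i : Fin n, A'.H i = A.H i.castSucc) (hr : A'.rank < A.rank)
    (S : Finset (Fin (n + 1))) : ¬ A.betaNbcBase 1 S := by
  have key : ∀ T, A.isBase T → Fin.last n ∈ T := by
    intro T hT
    by_contra hl
    obtain ⟨T', rfl⟩ := exists_eq_image_castSucc hl
    have h1 := ((indep_image_castSucc hamb' hH').1 hT.1).card_le_rank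
    rw [← hT.card_eq_rank, Finset.card_image_of_injective _ (Fin.castSucc_injective n)] at hr
    omega
  rintro ⟨⟨_, hS⟩, h⟩
  obtain ⟨j, hj, hB⟩ := h _ (key S hS)
  rcases Finset.mem_insert.1 (key _ hB) with h' | h'
  · exact hj.ne (by rw [h'])
  · exact Finset.notMem_erase _ _ h'

lemma betaNbcBase_image_castSucc (hamb' : A'.amb = A.amb)
    (hH' : ∀ i : Fin n, A'.H i = A.H i.castSucc) (hr : A.rank ≤ A'.rank)
    {S : Finset (Fin n)} : A.betaNbcBase 1 (S.image Fin.castSucc) ↔ A'.betaNbcBase 1 S := by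
  have hinj := Fin.castSucc_injective n
  have hbase : A.isBase (S.image Fin.castSucc) ↔ A'.isBase S := by
    constructor
    · intro h
      rw [isBase_iff, indep_image_castSucc hamb' hH', inter_image_castSucc hamb' hH'] at h
      exact A'.isBase_iff.2 ⟨h.1, fun i => hH' i ▸ h.2 _⟩
    · intro h
      have hi := (indep_image_castSucc hamb' hH').2 h.1
      refine A.isBase_iff_card.2 ⟨hi, le_antisymm hi.card_le_rank ?_⟩
      rw [Finset.card_image_of_injective _ hinj, h.card_eq_rank]
      exact hr
  have hfilter : ∀ i : Fin n, (S.image Fin.castSucc).filter (fun j => i.castSucc < j) =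
      (S.filter fun j => i < j).image Fin.castSucc := by
    intro i
    ext j
    induction j using Fin.lastCases <;> simp [Fin.castSucc_ne_last]
  have hlast : (S.image Fin.castSucc).filter (fun j => Fin.last n < j) = ∅ :=
    Finset.filter_eq_empty_iff.2 fun j _ => (Fin.le_last j).not_gt
  have herase : ∀ i : Fin n, (S.image Fin.castSucc).erase i.castSucc =
      (S.erase i).image Fin.castSucc := fun i => (Finset.image_erase hinj S i).symm
  rw [betaNbcBase_one_iff, betaNbcBase_one_iff, hbase]
  refine and_congr_right fun _ => and_congr ⟨fun h i => ?_, fun h i => ?_⟩ ?_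
  · have := h i.castSucc
    rwa [hfilter, inter_image_castSucc hamb' hH', ← hH'] at this
  · induction i using Fin.lastCases with
    | last => rw [hlast, inter_empty]; exact A.not_amb_le _
    | cast i =>
      rw [hfilter, inter_image_castSucc hamb' hH', ← hH']
      exact h i
  · rw [Finset.forall_mem_image]
    refine forall₂_congr fun i _ => ?_
    rw [herase, inter_image_castSucc hamb' hH']
    constructor
    · rintro ⟨j, hj, hd⟩
      obtain ⟨j, rfl⟩ := Fin.exists_castSucc_eq.2 (hj.trans_le (Fin.le_last _)).ne
      exact ⟨j, Fin.castSucc_lt_castSucc_iff.1 hj, hH' j ▸ hd⟩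
    · rintro ⟨j, hj, hd⟩
      exact ⟨j.castSucc, Fin.castSucc_lt_castSucc_iff.2 hj, hH' j ▸ hd⟩

end Deletion

section Restriction

variable {m : ℕ} {A : HArr W (n + 1)} {A'' : HArr W m} {ν : Fin m → Fin (n + 1)}

lemma restriction_ne_last
    (hsub : ∀ j : Fin m, ∃ i : Fin (n + 1), i ≠ Fin.last n ∧
      A''.H j = A.H i ⊓ A.H (Fin.last n))
    (hν : ∀ j, A''.H j ≤ A.H (ν j) ∧ ∀ i, A''.H j ≤ A.H i → ν j ≤ i) (j : Fin m) :
    ν j ≠ Fin.last n := by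
  obtain ⟨i, hi, h⟩ := hsub j
  have := (hν j).2 i (h ▸ inf_le_left)
  exact (this.trans_lt (Fin.lt_last_iff_ne_last.2 hi)).ne

lemma inter_insert_last (hamb'' : A''.amb = A.H (Fin.last n))
    (hH : ∀ j, A''.H j = A.H (ν j) ⊓ A.H (Fin.last n)) (S : Finset (Fin m)) :
    A.inter (insert (Fin.last n) (S.image ν)) = A''.inter S := by
  ext p
  have := A.le_amb (Fin.last n) (x := p)
  simp only [mem_inter, hamb'', hH, Finset.forall_mem_insert, Finset.forall_mem_image,
    AffineSubspace.mem_inf_iff]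
  grind

lemma direction_le_restriction (hamb'' : A''.amb = A.H (Fin.last n))
    (hH : ∀ j, A''.H j = A.H (ν j) ⊓ A.H (Fin.last n)) {X : AffineSubspace ℂ W}
    (hX : X ≤ A''.amb) (j : Fin m) :
    X.direction ≤ (A''.H j).direction ↔ X.direction ≤ (A.H (ν j)).direction := by
  obtain ⟨p, hp⟩ := A''.nonemptyH j
  have hp' : p ∈ A.H (ν j) ⊓ A.H (Fin.last n) := hH j ▸ hp
  rw [AffineSubspace.mem_inf_iff] at hp'
  rw [hH, AffineSubspace.direction_inf_of_mem hp'.1 hp'.2, le_inf_iff]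
  exact and_iff_left (AffineSubspace.direction_le (hamb'' ▸ hX))

variable [FiniteDimensional ℂ W]

lemma restriction_eq_inf (hamb'' : A''.amb = A.H (Fin.last n))
    (hsub : ∀ j : Fin m, ∃ i : Fin (n + 1), i ≠ Fin.last n ∧
      A''.H j = A.H i ⊓ A.H (Fin.last n))
    (hν : ∀ j, A''.H j ≤ A.H (ν j) ∧ ∀ i, A''.H j ≤ A.H i → ν j ≤ i) (j : Fin m) :
    A''.H j = A.H (ν j) ⊓ A.H (Fin.last n) := by
  have hle : A''.H j ≤ A.H (Fin.last n) ⊓ A.H (ν j) :=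
    le_inf (hamb'' ▸ A''.le_amb j) (hν j).1
  have hne := ne_bot_mono hle ((AffineSubspace.nonempty_iff_ne_bot _).1 (A''.nonemptyH j))
  have hd : ¬ (A.H (Fin.last n)).direction ≤ (A.H (ν j)).direction := by
    intro hd
    refine restriction_ne_last hsub hν j (A.inj ?_).symm
    refine AffineSubspace.eq_of_direction_eq_of_nonempty_of_le ?_ (A.nonemptyH _)
      (le_of_direction_le hne hd)
    refine Submodule.eq_of_le_of_finrank_eq hd ?_
    have := A.hyp (Fin.last n)
    have := A.hyp (ν j)
    omega
  have h1 := A.finrank_inf (A.le_amb _) (ne_bot_mono inf_le_left hne) hd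
  have h2 := A''.hyp j
  rw [hamb''] at h2
  rw [inf_comm]
  exact AffineSubspace.eq_of_direction_eq_of_nonempty_of_le
    (Submodule.eq_of_le_of_finrank_eq (AffineSubspace.direction_le hle) (by omega))
    (A''.nonemptyH j) hle

/-- A hyperplane whose direction does not contain that of a subspace of `H_n` meets `H_n`, and
cuts out a hyperplane of the restriction. -/
lemma exists_restriction (hamb'' : A''.amb = A.H (Fin.last n))
    (hsur : ∀ i : Fin (n + 1), i ≠ Fin.last n → A.H i ⊓ A.H (Fin.last n) ≠ ⊥ →
      ∃ j : Fin m, A''.H j = A.H i ⊓ A.H (Fin.last n))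
    {X : AffineSubspace ℂ W} (hX : X ≤ A''.amb) {i : Fin (n + 1)}
    (h : ¬ X.direction ≤ (A.H i).direction) :
    ∃ j : Fin m, A''.H j = A.H i ⊓ A.H (Fin.last n) := by
  have hXl := AffineSubspace.direction_le (hamb'' ▸ hX)
  refine hsur i (fun hi => h (hi ▸ hXl)) fun hb => h ?_
  rwa [A.direction_eq_of_inf_eq_bot hb]

lemma isBase_insert_last (hamb'' : A''.amb = A.H (Fin.last n))
    (hH : ∀ j, A''.H j = A.H (ν j) ⊓ A.H (Fin.last n))
    (hsur : ∀ i : Fin (n + 1), i ≠ Fin.last n → A.H i ⊓ A.H (Fin.last n) ≠ ⊥ →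
      ∃ j : Fin m, A''.H j = A.H i ⊓ A.H (Fin.last n))
    (hl : ∀ j, ν j ≠ Fin.last n) (hinj : Function.Injective ν) {S : Finset (Fin m)} :
    A.isBase (insert (Fin.last n) (S.image ν)) ↔ A''.isBase S := by
  have hnot : Fin.last n ∉ S.image ν := by simpa using fun j _ => hl j
  have hX := A''.inter_le_amb S
  rw [isBase_iff, isBase_iff, indep_iff, indep_iff, inter_insert_last hamb'' hH,
    Finset.card_insert_of_notMem hnot, Finset.card_image_of_injective _ hinj]
  have := A.hyp (Fin.last n)
  rw [hamb'', ← this, ← add_assoc, add_left_inj]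
  refine and_congr_right fun _ => ⟨fun h j => ?_, fun h i => ?_⟩
  · exact (direction_le_restriction hamb'' hH hX j).2 (h _)
  · by_contra hd
    obtain ⟨j, hj⟩ := exists_restriction hamb'' hsur hX hd
    exact hd ((h j).trans (AffineSubspace.direction_le (hj ▸ inf_le_left)))

lemma betaNbcBase_insert_last {A' : HArr W n} (hamb' : A'.amb = A.amb)
    (hH' : ∀ i : Fin n, A'.H i = A.H i.castSucc) (hr : A.rank ≤ A'.rank)
    (hamb'' : A''.amb = A.H (Fin.last n))
    (hsub : ∀ j : Fin m, ∃ i : Fin (n + 1), i ≠ Fin.last n ∧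
      A''.H j = A.H i ⊓ A.H (Fin.last n))
    (hsur : ∀ i : Fin (n + 1), i ≠ Fin.last n → A.H i ⊓ A.H (Fin.last n) ≠ ⊥ →
      ∃ j : Fin m, A''.H j = A.H i ⊓ A.H (Fin.last n))
    (hν : ∀ j, A''.H j ≤ A.H (ν j) ∧ ∀ i, A''.H j ≤ A.H i → ν j ≤ i)
    (hmono : StrictMono ν) {S : Finset (Fin m)} :
    A.betaNbcBase 1 (insert (Fin.last n) (S.image ν)) ↔ A''.betaNbcBase 1 S := by
  have hl := restriction_ne_last hsub hν
  have hH := restriction_eq_inf hamb'' hsub hν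
  have hnot : Fin.last n ∉ S.image ν := by simpa using fun j _ => hl j
  have hfilter : ∀ j, (insert (Fin.last n) (S.image ν)).filter (fun i => ν j < i) =
      insert (Fin.last n) ((S.filter fun k => j < k).image ν) := by
    intro j
    rw [Finset.filter_insert, if_pos (Fin.lt_last_iff_ne_last.2 (hl j)), Finset.filter_image]
    simp only [hmono.lt_iff_lt]
  have herase : ∀ j, (insert (Fin.last n) (S.image ν)).erase (ν j) =
      insert (Fin.last n) ((S.erase j).image ν) := by
    intro j
    rw [Finset.erase_insert_of_ne (hl j).symm, Finset.image_erase hmono.injective]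
  rw [betaNbcBase_one_iff, betaNbcBase_one_iff, isBase_insert_last hamb'' hH hsur hl hmono.injective]
  refine and_congr_right fun hbase => and_congr ⟨fun h j hj => ?_, fun h i hi => ?_⟩
    ⟨fun h j hj => ?_, fun h => ?_⟩
  · refine h (ν j) ?_
    rw [hfilter, inter_insert_last hamb'' hH]
    exact hj.trans (hν j).1
  · rcases eq_or_ne i (Fin.last n) with rfl | hne
    · rw [Finset.filter_eq_empty_iff.2 fun j _ => (Fin.le_last j).not_gt, inter_empty] at hi
      exact A.not_amb_le _ hi
    · have hil := Fin.lt_last_iff_ne_last.2 hne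
      have hle := le_inf hi (A.inter_le (i := Fin.last n) (by simp [hil]))
      have hb := ((isBase_insert_last hamb'' hH hsur hl hmono.injective).2 hbase).1.1
      obtain ⟨j, hj⟩ := hsur i hne
        (ne_bot_mono ((A.inter_anti (Finset.filter_subset _ _)).trans hle) hb)
      refine h j ?_
      rw [← inter_insert_last hamb'' hH, ← hfilter, hj]
      refine (A.inter_anti fun k hk => ?_).trans hle
      rw [Finset.mem_filter] at hk ⊢
      exact ⟨hk.1, ((hν j).2 i (hj ▸ inf_le_left)).trans_lt hk.2⟩
  · obtain ⟨i, hi, hd⟩ := h (ν j) (Finset.mem_insert_of_mem (Finset.mem_image_of_mem ν hj))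
    rw [herase, inter_insert_last hamb'' hH] at hd
    obtain ⟨k, hk⟩ := exists_restriction hamb'' hsur (A''.inter_le_amb _) hd
    have hki : A''.H k ≤ A.H i := hk ▸ inf_le_left
    exact ⟨k, hmono.lt_iff_lt.1 (((hν k).2 i hki).trans_lt hi),
      fun hd' => hd (hd'.trans (AffineSubspace.direction_le hki))⟩
  · rw [Finset.forall_mem_insert, Finset.forall_mem_image, Finset.erase_insert hnot]
    constructor
    · have hb := (isBase_insert_last hamb'' hH hsur hl hmono.injective).2 hbase
      by_contra! hcon
      obtain ⟨T, hT⟩ := exists_eq_image_castSucc hnot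
      have hcard := hb.card_eq_rank
      have hi := hb.1.subset (Finset.subset_insert _ _)
      rw [Finset.card_insert_of_notMem hnot] at hcard
      rw [hT] at hcard hi hcon
      rw [indep_image_castSucc hamb' hH'] at hi
      rw [inter_image_castSucc hamb' hH'] at hcon
      have hbT : A'.isBase T := A'.isBase_iff.2
        ⟨hi, fun i => hH' i ▸ hcon _ (Fin.castSucc_lt_last i)⟩
      have := hbT.card_eq_rank
      rw [Finset.card_image_of_injective _ (Fin.castSucc_injective n)] at hcard
      omega
    · intro j hj
      obtain ⟨k, hk, hd⟩ := h j hj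
      rw [direction_le_restriction hamb'' hH (A''.inter_le_amb _)] at hd
      refine ⟨ν k, hmono hk, ?_⟩
      rwa [herase, inter_insert_last hamb'' hH]

lemma exists_eq_insert_last
    (hsur : ∀ i : Fin (n + 1), i ≠ Fin.last n → A.H i ⊓ A.H (Fin.last n) ≠ ⊥ →
      ∃ j : Fin m, A''.H j = A.H i ⊓ A.H (Fin.last n))
    (hν : ∀ j, A''.H j ≤ A.H (ν j) ∧ ∀ i, A''.H j ≤ A.H i → ν j ≤ i)
    (hl : ∀ j, ν j ≠ Fin.last n) {S : Finset (Fin (n + 1))} (hS : A.betaNbcBase 1 S)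
    (hlS : Fin.last n ∈ S) :
    ∃ T : Finset (Fin m), S = insert (Fin.last n) (T.image ν) := by
  obtain ⟨hb, hnbc, -⟩ := A.betaNbcBase_one_iff.1 hS
  refine ⟨Finset.univ.filter fun j => ν j ∈ S, ?_⟩
  ext i
  simp only [Finset.mem_insert, Finset.mem_image, Finset.mem_filter, Finset.mem_univ, true_and]
  constructor
  · refine fun hi => or_iff_not_imp_left.2 fun hne => ?_
    obtain ⟨j, hj⟩ := hsur i hne
      (ne_bot_mono (le_inf (A.inter_le hi) (A.inter_le hlS)) hb.1.1)
    suffices ν j = i from ⟨j, this ▸ hi, this⟩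
    by_contra hji
    have hlt := lt_of_le_of_ne ((hν j).2 i (hj ▸ inf_le_left)) hji
    refine hnbc (ν j) (le_trans (le_inf (A.inter_le (Finset.mem_filter.2 ⟨hi, hlt⟩))
      (A.inter_le (Finset.mem_filter.2 ⟨hlS, ?_⟩))) (hj ▸ (hν j).1))
    exact Fin.lt_last_iff_ne_last.2 (hl j)
  · rintro (rfl | ⟨j, hj, rfl⟩)
    · exact hlS
    · exact hj

end Restriction

end HArr

open scoped Classical
/-- Ziegler's deletion–restriction for β-systems.  Let `A'` be the
deletion of the last hyperplane and `A''` the restriction to it (an arrangement inside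
`H_n`, ordered via `ν`).  If `H_n` is a separator then `βnbc(𝒜) = ∅`, and otherwise
`βnbc(𝒜) = βnbc(𝒜') ∪ {(ν(B''), H_n) : B'' ∈ βnbc(𝒜'')}`. -/
theorem betaNbc_deletion_restriction {W : Type} [AddCommGroup W] [Module ℂ W]
    [FiniteDimensional ℂ W] {n m : ℕ}
    (A : HArr W (n + 1)) (A' : HArr W n) (A'' : HArr W m)
    (hamb' : A'.amb = A.amb)
    (hH' : ∀ i : Fin n, A'.H i = A.H i.castSucc)
    (hamb'' : A''.amb = A.H (Fin.last n))
    (hsub : ∀ j : Fin m, ∃ i : Fin (n + 1), i ≠ Fin.last n ∧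
      A''.H j = A.H i ⊓ A.H (Fin.last n))
    (hsur : ∀ i : Fin (n + 1), i ≠ Fin.last n → A.H i ⊓ A.H (Fin.last n) ≠ ⊥ →
      ∃ j : Fin m, A''.H j = A.H i ⊓ A.H (Fin.last n))
    (ν : Fin m → Fin (n + 1))
    (hν : ∀ j, A''.H j ≤ A.H (ν j) ∧ ∀ i, A''.H j ≤ A.H i → ν j ≤ i)
    (hord : ∀ j k : Fin m, j < k ↔ ν j < ν k) :
    (A'.rank < A.rank → ∀ S, ¬ A.betaNbcBase 1 S) ∧
    (¬ A'.rank < A.rank → ∀ S : Finset (Fin (n + 1)),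
      A.betaNbcBase 1 S ↔
        ((∃ S' : Finset (Fin n), A'.betaNbcBase 1 S' ∧ S = S'.image Fin.castSucc) ∨
         (∃ S'' : Finset (Fin m), A''.betaNbcBase 1 S'' ∧
            S = insert (Fin.last n) (S''.image ν)))) := by
  refine ⟨fun hr => HArr.not_betaNbcBase_of_rank_lt hamb' hH' hr, fun hr S => ?_⟩
  have hr' := not_lt.1 hr
  have hmono : StrictMono ν := fun j k => (hord j k).1
  constructor
  · intro hS
    by_cases hl : Fin.last n ∈ S
    · obtain ⟨T, rfl⟩ :=
        HArr.exists_eq_insert_last hsur hν (HArr.restriction_ne_last hsub hν) hS hl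
      exact Or.inr ⟨T, (HArr.betaNbcBase_insert_last hamb' hH' hr' hamb'' hsub hsur hν
        hmono).1 hS, rfl⟩
    · obtain ⟨T, rfl⟩ := HArr.exists_eq_image_castSucc hl
      exact Or.inl ⟨T, (HArr.betaNbcBase_image_castSucc hamb' hH' hr').1 hS, rfl⟩
  · rintro (⟨T, hT, rfl⟩ | ⟨T, hT, rfl⟩)
    · exact (HArr.betaNbcBase_image_castSucc hamb' hH' hr').2 hT
    · exact (HArr.betaNbcBase_insert_last hamb' hH' hr' hamb'' hsub hsur hν hmono).2 hT
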